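/- arXiv:2306.12209 — 3 statements merged into one kernel-verified Lean document; each statement's English description precedes it below -/
import Mathlib

section
/- Let m ≥ 4 be an even integer. Then the digraph Γ*_m = C*[2] ⊕ F_m*[2] has a factorization into r C⃗_m-factors and s C⃗_{2m}-factors for every r ∈ {0, 6} with r + s = 6; that is, Γ*_m has both a C⃗_{2m}-factorization (into six C⃗_{2m}-factors) and a C⃗_m-factorization (into six C⃗_m-factors). -/
/-- A factorization of the digraph with arc set `A` (on vertex set `V`) into `k`
arc-disjoint spanning factors, where every connected component of the `i`-th factor
is a directed cycle of length `c i` (a `C⃗_{c i}`-factor; for `c i = 2` this is a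
`K_2*`-factor, i.e. its components are double arcs).  The `i`-th factor is encoded by
a permutation `f i` of the vertex set, its arc set being `{(x, f i x) : x ∈ V}`;
the requirement that all components be directed `c i`-cycles says exactly that every
point of `f i` has minimal period `c i`.  The factors are pairwise arc-disjoint and
their arc sets partition `A`. -/
def IsFactorization {V : Type} (A : Set (V × V)) {k : ℕ} (c : Fin k → ℕ) : Prop :=
  ∃ f : Fin k → Equiv.Perm V,
    (∀ (i : Fin k) (x : V), Function.minimalPeriod (⇑(f i)) x = c i) ∧
    (∀ (i j : Fin k) (x : V), f i x = f j x → i = j) ∧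
    (∀ p : V × V, p ∈ A ↔ ∃ i, f i p.1 = p.2)

/-- The arc set of `C_m*[2]` on vertex set `Fin 2 × ZMod m`: here `C_m*` is the
symmetric digraph of the `m`-cycle `(0, 1, …, m-1)` on `ZMod m`, and `D[2]` has an arc
from `(i, u)` to `(j, v)` for all `i j : Fin 2` whenever `(u, v)` is an arc of `D`. -/
def cycleStarBlowup (m : ℕ) : Set ((Fin 2 × ZMod m) × (Fin 2 × ZMod m)) :=
  {p | p.2.2 = p.1.2 + 1 ∨ p.1.2 = p.2.2 + 1}

/-- The arc set of `I*_{2m}` on vertex set `Fin 2 × ZMod m`: the `K_2*`-factor whose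
components are the double arcs joining `(0, i)` and `(1, i)` for each `i : ZMod m`. -/
def IStar (m : ℕ) : Set ((Fin 2 × ZMod m) × (Fin 2 × ZMod m)) :=
  {p | p.1.2 = p.2.2 ∧ p.1.1 ≠ p.2.1}

/-- The arc set of `F_m*[2]` on vertex set `Fin 2 × ZMod m` (for even `m`): here `F_m`
is the 1-factor of `K_m` on `ZMod m` with edges `{0, m/2}` and `{i, m - i}` for
`1 ≤ i ≤ m/2 - 1`, `F_m*` is its symmetric digraph, and `D[2]` has an arc from `(i, u)`
to `(j, v)` for all `i j : Fin 2` whenever `(u, v)` is an arc of `D`. -/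
def FStarBlowup (m : ℕ) : Set ((Fin 2 × ZMod m) × (Fin 2 × ZMod m)) :=
  {p | (p.1.2 = 0 ∧ p.2.2 = ((m / 2 : ℕ) : ZMod m)) ∨
       (p.1.2 = ((m / 2 : ℕ) : ZMod m) ∧ p.2.2 = 0) ∨
       (p.1.2 ≠ 0 ∧ p.1.2 ≠ ((m / 2 : ℕ) : ZMod m) ∧ p.2.2 = -p.1.2)}

/-- The arc set of `Γ*_m = C*[2] ⊕ F_m*[2]`, the arc-disjoint union of `C*[2]` and
`F_m*[2]` on vertex set `Fin 2 × ZMod m`. -/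
def GammaStar (m : ℕ) : Set ((Fin 2 × ZMod m) × (Fin 2 × ZMod m)) :=
  cycleStarBlowup m ∪ FStarBlowup m

/-- The neighbour of `a` (as a natural number below `m`) in direction `d`: the successor,
the predecessor, or the partner in the 1-factor `F_m`. -/
def natNeighbor (m : ℕ) (d : Fin 3) (a : ℕ) : ℕ :=
  ![if a + 1 = m then 0 else a + 1, if a = 0 then m - 1 else a - 1,
    if a = 0 then m / 2 else if a = m / 2 then 0 else m - a] d

/-- The neighbour of `u` in direction `d`. -/
def neighbor (m : ℕ) (d : Fin 3) (u : ZMod m) : ZMod m := (natNeighbor m d u.val : ℕ)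

/-- The position of a vertex in the ladder: an end vertex, or a side of the ladder together with
a parity. -/
def position (m a : ℕ) : Fin 7 :=
  if a = 0 then 0
  else if a < m / 2 then (if a % 2 = 1 then 1 else 2)
  else if a = m / 2 then (if a % 2 = 0 then 5 else 6)
  else if a % 2 = 1 then 3 else 4

/-- The direction in which the `i`-th directed Hamiltonian cycle leaves a vertex of the given
position. The cycles are `C`, its reverse, the two zigzags, and their reverses. -/
def direction : Fin 7 → Fin 6 → Fin 3 :=
  ![![0, 1, 0, 1, 2, 2], ![0, 1, 2, 0, 1, 2], ![0, 1, 0, 2, 2, 1], ![0, 1, 1, 2, 2, 0],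
    ![0, 1, 2, 1, 0, 2], ![0, 1, 2, 2, 0, 1], ![0, 1, 2, 2, 1, 0]]

/-- The voltage distinguishing the two Hamiltonian cycles that leave a vertex in the same
direction. -/
def baseVoltage (c : Fin 7) (i : Fin 6) : Fin 2 :=
  if ∃ j < i, direction c j = direction c i then 1 else 0

theorem direction_baseVoltage_injective (c : Fin 7) (i j : Fin 6)
    (hd : direction c i = direction c j) (hv : baseVoltage c i = baseVoltage c j) : i = j := by
  revert c i j; decide

theorem exists_direction_baseVoltage (c : Fin 7) (d : Fin 3) (b : Fin 2) :
    ∃ i, direction c i = d ∧ baseVoltage c i = b := by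
  revert c d b; decide

theorem sum_baseVoltage (c : Fin 7) : ∑ i, baseVoltage c i = 1 := by
  revert c; decide

/-- The `i`-th Hamiltonian cycle of `Γ_m`. -/
def hamStep (m : ℕ) (i : Fin 6) (u : ZMod m) : ZMod m :=
  neighbor m (direction (position m u.val) i) u

/-- One zigzag through the ladder: `0, 1, -1, -2, 2, 3, -3, …`. -/
def zigzag (m t : ℕ) : ℕ :=
  if t = 0 then 0 else if t % 4 ≤ 1 then (t + 1) / 2 else m - (t + 1) / 2

/-- The other zigzag through the ladder: `0, -1, 1, 2, -2, -3, 3, …`. -/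
def zagzig (m t : ℕ) : ℕ :=
  if t = 0 then 0 else if t % 4 ≤ 1 then m - (t + 1) / 2 else (t + 1) / 2

/-- The vertices of the `i`-th Hamiltonian cycle in order. -/
def hamSeq (m : ℕ) (i : Fin 6) (t : ℕ) : ℕ :=
  ![t, m - 1 - t, zigzag m t, zagzig m t, zigzag m (m - 1 - t), zagzig m (m - 1 - t)] i

theorem natNeighbor_lt {m a : ℕ} (hm : 4 ≤ m) (ha : a < m) (d : Fin 3) :
    natNeighbor m d a < m := by
  fin_cases d <;> simp [natNeighbor] <;> split_ifs <;> omega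

theorem natNeighbor_injective {m a : ℕ} (hm : 4 ≤ m) (hme : Even m) (ha : a < m) :
    Function.Injective fun d => natNeighbor m d a := by
  obtain ⟨k, rfl⟩ := hme
  intro d d' h
  fin_cases d <;> fin_cases d' <;> simp [natNeighbor] at h ⊢ <;> split_ifs at h <;> omega

theorem hamSeq_lt {m t : ℕ} (hm : 4 ≤ m) (ht : t < m) (i : Fin 6) : hamSeq m i t < m := by
  fin_cases i <;> simp [hamSeq, zigzag, zagzig] <;> try split_ifs
  all_goals omega

theorem hamSeq_injOn {m s t : ℕ} (hme : Even m) (hs : s < m) (ht : t < m) (i : Fin 6)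
    (h : hamSeq m i s = hamSeq m i t) : s = t := by
  obtain ⟨k, rfl⟩ := hme
  fin_cases i <;> simp [hamSeq, zigzag, zagzig] at h <;> try split_ifs at h
  all_goals omega

theorem natNeighbor_direction {m a : ℕ} (hm : 4 ≤ m) (hme : Even m) (ha : a < m) (i : Fin 6) :
    natNeighbor m (direction (position m a) i) a =
      ![if a + 1 = m then 0 else a + 1,
        if a = 0 then m - 1 else a - 1,
        if a = m / 2 then 0
          else if a < m / 2 then (if a % 2 = 0 then a + 1 else m - a)
          else if a % 2 = 1 then a - 1 else m - a,
        if a = 0 then m - 1 else if a = m / 2 then 0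
          else if a < m / 2 then (if a % 2 = 1 then a + 1 else m - a)
          else if a % 2 = 0 then a - 1 else m - a,
        if a = 0 then m / 2 else if a = m / 2 then (if a % 2 = 0 then a + 1 else a - 1)
          else if a < m / 2 then (if a % 2 = 1 then a - 1 else m - a)
          else if a % 2 = 0 then a + 1 else m - a,
        if a = 0 then m / 2 else if a = m / 2 then (if a % 2 = 0 then a - 1 else a + 1)
          else if a < m / 2 then (if a % 2 = 0 then a - 1 else m - a)
          else if a % 2 = 0 then m - a else if a + 1 = m then 0 else a + 1] i := by
  obtain ⟨k, rfl⟩ := hme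
  unfold position
  split_ifs <;> fin_cases i <;>
    simp only [direction, natNeighbor, Fin.isValue, Fin.mk_one, Fin.zero_eta, Fin.reduceFinMk,
      Matrix.cons_val] <;>
    (try split_ifs) <;> omega

theorem natNeighbor_hamSeq {m t : ℕ} (hm : 4 ≤ m) (hme : Even m) (ht : t < m) (i : Fin 6) :
    natNeighbor m (direction (position m (hamSeq m i t)) i) (hamSeq m i t) =
      hamSeq m i (if t + 1 = m then 0 else t + 1) := by
  rw [natNeighbor_direction hm hme (hamSeq_lt hm ht i)]
  obtain ⟨k, rfl⟩ := hme
  fin_cases i <;>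
    simp only [hamSeq, zigzag, zagzig, Fin.isValue, Fin.mk_one, Fin.zero_eta, Fin.reduceFinMk,
      Matrix.cons_val]
  all_goals grind

theorem val_neighbor {m : ℕ} (hm : 4 ≤ m) (d : Fin 3) (u : ZMod m) :
    (neighbor m d u).val = natNeighbor m d u.val := by
  have : NeZero m := ⟨by omega⟩
  exact ZMod.val_cast_of_lt (natNeighbor_lt hm u.val_lt d)

theorem neighbor_injective {m : ℕ} (hm : 4 ≤ m) (hme : Even m) (u : ZMod m) :
    Function.Injective fun d => neighbor m d u := by
  have : NeZero m := ⟨by omega⟩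
  intro d d' h
  refine natNeighbor_injective hm hme u.val_lt ?_
  simpa only [val_neighbor hm] using congrArg ZMod.val h

theorem mem_gammaStar_iff {m : ℕ} (hm : 4 ≤ m) (a b : Fin 2) (u w : ZMod m) :
    ((a, u), (b, w)) ∈ GammaStar m ↔ ∃ d, neighbor m d u = w := by
  have : NeZero m := ⟨by omega⟩
  have h0 : neighbor m 0 u = u + 1 := by
    simp only [neighbor, natNeighbor, Matrix.cons_val]
    split_ifs with h
    · have : ((u.val + 1 : ℕ) : ZMod m) = 0 := by rw [h]; simp
      simpa using this.symm
    · simp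
  have h1 : neighbor m 1 u = u - 1 := by
    simp only [neighbor, natNeighbor, Matrix.cons_val]
    split_ifs with h
    · rw [ZMod.val_eq_zero] at h
      subst h
      rw [Nat.cast_sub (by omega)]; simp
    · rw [Nat.cast_sub (by omega)]; simp
  have h2 : neighbor m 2 u =
      if u = 0 then ((m / 2 : ℕ) : ZMod m) else if u = ((m / 2 : ℕ) : ZMod m) then 0 else -u := by
    have hk : u.val = m / 2 ↔ u = ((m / 2 : ℕ) : ZMod m) := by
      rw [← (ZMod.val_injective m).eq_iff, ZMod.val_cast_of_lt (by omega)]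
    simp only [neighbor, natNeighbor, Matrix.cons_val, ZMod.val_eq_zero, hk]
    split_ifs
    · rfl
    · simp
    · rw [Nat.cast_sub u.val_lt.le]; simp
  have hk0 : ((m / 2 : ℕ) : ZMod m) ≠ 0 := by
    intro h
    have := congrArg ZMod.val h
    rw [ZMod.val_cast_of_lt (by omega), ZMod.val_zero] at this
    omega
  have hexists : (∃ d, neighbor m d u = w) ↔
      w = u + 1 ∨ u = w + 1 ∨ neighbor m 2 u = w := by
    rw [Fin.exists_fin_succ, Fin.exists_fin_two]
    change neighbor m 0 u = w ∨ neighbor m 1 u = w ∨ neighbor m 2 u = w ↔ _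
    rw [h0, h1, sub_eq_iff_eq_add, eq_comm (a := u + 1)]
  rw [hexists, h2]
  simp only [GammaStar, cycleStarBlowup, FStarBlowup, Set.mem_union, Set.mem_ofPred_eq, or_assoc]
  by_cases hu : u = 0
  · subst hu; simp [hk0.symm, eq_comm]
  · by_cases hu' : u = ((m / 2 : ℕ) : ZMod m)
    · subst hu'; simp [hk0, eq_comm]
    · simp [hu, hu', eq_comm]

/-- A self-map of an `m`-element type that runs cyclically through `m` distinct elements
is bijective with all minimal periods equal to `m`. -/
theorem bijective_and_minimalPeriod_of_cyclic {α : Type*} [Fintype α] {m : ℕ} (hm : 0 < m)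
    (hcard : Fintype.card α = m) (h : α → α) (e : ℕ → α)
    (hinj : ∀ s t, s < m → t < m → e s = e t → s = t)
    (hstep : ∀ t < m, h (e t) = e (if t + 1 = m then 0 else t + 1)) :
    Function.Bijective h ∧ ∀ x, Function.minimalPeriod h x = m := by
  have hsurj : ∀ x, ∃ t < m, e t = x := by
    have hb : Function.Bijective fun t : Fin m => e t :=
      (Fintype.bijective_iff_injective_and_card _).2
        ⟨fun s t hst => Fin.ext (hinj _ _ s.2 t.2 hst), by simp [hcard]⟩
    intro x
    obtain ⟨t, ht⟩ := hb.surjective x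
    exact ⟨t, t.2, ht⟩
  have hiter : ∀ t < m, h^[t] (e 0) = e t := by
    intro t
    induction t with
    | zero => intro; rfl
    | succ t ih =>
      intro ht
      rw [Function.iterate_succ_apply', ih (by omega), hstep t (by omega), if_neg (by omega)]
  have hper : Function.IsPeriodicPt h m (e 0) := by
    obtain ⟨k, rfl⟩ : ∃ k, m = k + 1 := ⟨m - 1, by omega⟩
    rw [Function.IsPeriodicPt, Function.IsFixedPt, Function.iterate_succ_apply',
      hiter k (by omega), hstep k (by omega), if_pos rfl]
  have hmin : Function.minimalPeriod h (e 0) = m := by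
    refine (hper.minimalPeriod_le hm).antisymm (not_lt.1 fun hlt => ?_)
    have h0 := hinj _ 0 hlt hm ((hiter _ hlt).symm.trans (Function.iterate_minimalPeriod))
    exact (hper.minimalPeriod_pos hm).ne' h0
  refine ⟨(Finite.injective_iff_bijective.1 (Finite.injective_iff_surjective.2 fun x => ?_)),
    fun x => ?_⟩
  · obtain ⟨t, ht, rfl⟩ := hsurj x
    rcases t with _ | t
    · exact ⟨e (m - 1), by rw [hstep _ (by omega), if_pos (by omega)]⟩
    · exact ⟨e t, by rw [hstep _ (by omega), if_neg (by omega)]⟩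
  · obtain ⟨t, ht, rfl⟩ := hsurj x
    rw [← hiter t ht, Function.minimalPeriod_apply_iterate ⟨m, hm, hper⟩, hmin]

theorem hamStep_cyclic {m : ℕ} (hm : 4 ≤ m) (hme : Even m) (i : Fin 6) :
    Function.Bijective (hamStep m i) ∧ ∀ u, Function.minimalPeriod (hamStep m i) u = m := by
  have : NeZero m := ⟨by omega⟩
  refine bijective_and_minimalPeriod_of_cyclic (by omega) (ZMod.card m) _
    (fun t => (hamSeq m i t : ZMod m)) (fun s t hs ht h => ?_) fun t ht => ?_
  · have := congrArg ZMod.val h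
    simp only [ZMod.val_cast_of_lt (hamSeq_lt hm hs i),
      ZMod.val_cast_of_lt (hamSeq_lt hm ht i)] at this
    exact hamSeq_injOn hme hs ht i this
  · simp only [hamStep, neighbor, ZMod.val_cast_of_lt (hamSeq_lt hm ht i),
      natNeighbor_hamSeq hm hme ht]

/-- The lift of `h` to the twofold cover determined by the voltage `v`. -/
def voltageLift {α : Type*} (h : α → α) (v : α → Fin 2) (x : Fin 2 × α) : Fin 2 × α :=
  (x.1 + v x.2, h x.2)

theorem voltageLift_injective {α : Type*} {h : α → α} (v : α → Fin 2)
    (hh : Function.Injective h) : Function.Injective (voltageLift h v) := by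
  rintro ⟨a, u⟩ ⟨b, w⟩ hab
  simp only [voltageLift, Prod.mk.injEq] at hab
  obtain rfl := hh hab.2
  simpa using hab.1

theorem voltageLift_iterate {α : Type*} (h : α → α) (v : α → Fin 2) (n : ℕ) (x : Fin 2 × α) :
    (voltageLift h v)^[n] x = (x.1 + ∑ s ∈ Finset.range n, v (h^[s] x.2), h^[n] x.2) := by
  induction n with
  | zero => simp
  | succ n ih =>
    rw [Function.iterate_succ_apply', ih, Function.iterate_succ_apply', Finset.sum_range_succ,
      ← add_assoc]
    rfl

theorem sum_range_minimalPeriod {α : Type*} [Fintype α] {h : α → α} {m : ℕ}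
    (hcard : Fintype.card α = m) (hper : ∀ u, Function.minimalPeriod h u = m) (v : α → Fin 2)
    (u : α) : ∑ s ∈ Finset.range m, v (h^[s] u) = ∑ w, v w := by
  rw [← Fin.sum_univ_eq_sum_range (fun s => v (h^[s] u))]
  refine Function.Bijective.sum_comp (e := fun s : Fin m => h^[s] u)
    ((Fintype.bijective_iff_injective_and_card _).2 ⟨fun s t hst => Fin.ext ?_, by simp [hcard]⟩) v
  exact Function.iterate_injOn_Iio_minimalPeriod (by simp [hper]) (by simp [hper]) hst

theorem minimalPeriod_voltageLift {α : Type*} [Fintype α] {h : α → α} {m : ℕ} (hm : 0 < m)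
    (hcard : Fintype.card α = m) (hper : ∀ u, Function.minimalPeriod h u = m) (v : α → Fin 2)
    (x : Fin 2 × α) :
    Function.minimalPeriod (voltageLift h v) x = if ∑ w, v w = 0 then m else 2 * m := by
  have hround : ∀ y, (voltageLift h v)^[m] y = (y.1 + ∑ w, v w, y.2) := by
    intro y
    rw [voltageLift_iterate, sum_range_minimalPeriod hcard hper]
    have := Function.iterate_minimalPeriod (f := h) (x := y.2)
    rw [hper] at this
    rw [this]
  have hdvd : m ∣ Function.minimalPeriod (voltageLift h v) x := by
    rw [← hper x.2]
    apply Function.IsPeriodicPt.minimalPeriod_dvd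
    have := Function.iterate_minimalPeriod (f := voltageLift h v) (x := x)
    rw [voltageLift_iterate] at this
    exact congrArg Prod.snd this
  split_ifs with hv
  · refine Nat.dvd_antisymm (Function.IsPeriodicPt.minimalPeriod_dvd ?_) hdvd
    exact (hround x).trans (by simp [hv])
  · have hv : ∑ w, v w = 1 := by omega
    have h2 : Function.minimalPeriod (voltageLift h v) x ∣ 2 * m := by
      apply Function.IsPeriodicPt.minimalPeriod_dvd
      rw [Function.IsPeriodicPt, Function.IsFixedPt, two_mul, Function.iterate_add_apply, hround,
        hround, hv, add_assoc]
      simp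
    obtain ⟨c, hc⟩ := hdvd
    have hc2 : c ∣ 2 := by
      rw [hc, mul_comm 2] at h2
      exact Nat.dvd_of_mul_dvd_mul_left hm h2
    rcases (Nat.dvd_prime Nat.prime_two).1 hc2 with rfl | rfl
    · have := Function.iterate_minimalPeriod (f := voltageLift h v) (x := x)
      rw [hc, mul_one, hround, hv] at this
      have := congrArg Prod.fst this
      simp at this
    · rw [hc, mul_comm]

/-- Adjusting the voltages at the two end vertices realizes every constant net voltage. -/
theorem exists_end_voltages (c : Fin 7) (hc : c = 5 ∨ c = 6) (S : Fin 6 → Fin 2)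
    (hS : ∑ i, S i = 0) (b : Fin 2) :
    ∃ x y : Fin 3 → Fin 2, ∀ i, S i + (x (direction 0 i) + y (direction c i)) = b := by
  refine ⟨![b - S 2, b - S 3, b - S 4 - ![b - S 0 - (b - S 2), b - S 1 - (b - S 3), 0]
    (direction c 4)], ![b - S 0 - (b - S 2), b - S 1 - (b - S 3), 0], ?_⟩
  have hS5 : ∀ s₀ s₁ s₂ s₃ s₄ s₅ : Fin 2, s₀ + s₁ + s₂ + s₃ + s₄ + s₅ = 0 →
      s₅ + (b - s₄ - (b - s₀ - (b - s₂)) + (b - s₁ - (b - s₃))) = b ∧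
      s₅ + (b - s₄ - (b - s₁ - (b - s₃)) + (b - s₀ - (b - s₂))) = b := by
    revert b; decide
  have h5 := hS5 _ _ _ _ _ _ (Fin.sum_univ_six S ▸ hS)
  intro i
  rcases hc with rfl | rfl <;> fin_cases i <;>
    simp only [direction, Fin.isValue, Fin.mk_one, Fin.zero_eta, Fin.reduceFinMk,
      Matrix.cons_val] <;>
    first | exact h5.1 | exact h5.2 | abel

theorem exists_voltages {m : ℕ} (hm : 4 ≤ m) [NeZero m] (hme : Even m) (b : Fin 2) :
    ∃ t : ZMod m → Fin 3 → Fin 2, ∀ i, ∑ u : ZMod m,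
      (baseVoltage (position m u.val) i + t u (direction (position m u.val) i)) = b := by
  set k : ZMod m := ((m / 2 : ℕ) : ZMod m)
  have hkval : k.val = m / 2 := ZMod.val_cast_of_lt (by omega)
  have hk0 : k ≠ 0 := by
    intro h
    rw [h, ZMod.val_zero] at hkval
    omega
  have hc : position m k.val = 5 ∨ position m k.val = 6 := by
    rw [hkval, position, if_neg (by omega), if_neg (by omega), if_pos rfl]
    split_ifs <;> simp
  have hS : ∑ i, ∑ u : ZMod m, baseVoltage (position m u.val) i = 0 := by
    rw [Finset.sum_comm]
    simp only [sum_baseVoltage, Finset.sum_const, Finset.card_univ, ZMod.card]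
    obtain ⟨l, rfl⟩ := hme
    rw [add_nsmul, ← nsmul_add]
    simp
  obtain ⟨x, y, hxy⟩ := exists_end_voltages _ hc _ hS b
  refine ⟨fun u d => (if u = 0 then x d else 0) + if u = k then y d else 0, fun i => ?_⟩
  rw [← hxy i, Finset.sum_add_distrib, Finset.sum_add_distrib, Finset.sum_ite_eq',
    Finset.sum_ite_eq']
  simp [position]

theorem isFactorization_gammaStar {m : ℕ} (hm : 4 ≤ m) (hme : Even m) (b : Fin 2) :
    IsFactorization (GammaStar m) (fun _ : Fin 6 => if b = 0 then m else 2 * m) := by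
  have : NeZero m := ⟨by omega⟩
  obtain ⟨t, ht⟩ := exists_voltages hm hme b
  let v (i : Fin 6) (u : ZMod m) : Fin 2 :=
    baseVoltage (position m u.val) i + t u (direction (position m u.val) i)
  have hbij (i : Fin 6) : Function.Bijective (voltageLift (hamStep m i) (v i)) :=
    Finite.injective_iff_bijective.1
      (voltageLift_injective _ (hamStep_cyclic hm hme i).1.injective)
  refine ⟨fun i => Equiv.ofBijective _ (hbij i), fun i x => ?_, ?_, ?_⟩
  · rw [Equiv.coe_ofBijective, minimalPeriod_voltageLift (by omega) (ZMod.card m)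
      (hamStep_cyclic hm hme i).2, ht i]
  · intro i j x hij
    simp only [Equiv.ofBijective_apply, voltageLift, Prod.mk.injEq, add_right_inj, v] at hij
    have hd : direction (position m x.2.val) i = direction (position m x.2.val) j :=
      neighbor_injective hm hme x.2 hij.2
    refine direction_baseVoltage_injective _ i j hd ?_
    simpa [hd] using hij.1
  · rintro ⟨⟨a, u⟩, b', w⟩
    rw [mem_gammaStar_iff hm]
    constructor
    · rintro ⟨d, rfl⟩
      obtain ⟨i, rfl, hi⟩ := exists_direction_baseVoltage (position m u.val) d
        (b' - a - t u d)
      refine ⟨i, ?_⟩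
      simp only [Equiv.ofBijective_apply, voltageLift, v, hi, hamStep, Prod.mk.injEq, and_true]
      abel
    · rintro ⟨i, hi⟩
      exact ⟨_, congrArg Prod.snd hi⟩

/-- For even `m ≥ 4`, the digraph `Γ*_m = C*[2] ⊕ F_m*[2]` has a factorization into
`r` `C⃗_m`-factors and `s` `C⃗_{2m}`-factors for every `r ∈ {0, 6}` with `r + s = 6`;
that is, `Γ*_m` has both a `C⃗_{2m}`-factorization (into six `C⃗_{2m}`-factors) and a
`C⃗_m`-factorization (into six `C⃗_m`-factors). -/
theorem gammaStar_Cm_C2m (m r s : ℕ) (hm : 4 ≤ m) (hme : Even m)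
    (hr : r = 0 ∨ r = 6) (hrs : r + s = 6) :
    IsFactorization (GammaStar m)
      (fun i : Fin (r + s) => if (i : ℕ) < r then m else 2 * m) := by
  rcases hr with rfl | rfl
  · obtain rfl : s = 6 := by omega
    simpa using isFactorization_gammaStar hm hme 1
  · obtain rfl : s = 0 := by omega
    simpa using isFactorization_gammaStar hm hme 0
end

section
/- Let m ≥ 4 be an even integer. Then the digraph C_m*[2] ⊕ I*_{2m} has a factorization into r C⃗_m-factors and s C⃗_{2m}-factors for every r ∈ {1, 3} with r + s = 5. -/
theorem Fin.add_one_eq_iff_ne (b c : Fin 2) : b + 1 = c ↔ b ≠ c := by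
  decide +revert

theorem Fin.add_one_add_one (b : Fin 2) : b + 1 + 1 = b := by
  decide +revert

/-- The skew product over the translation `i ↦ i + e` of `ZMod m` with cocycle `g`. -/
def skewPerm {m : ℕ} (e : ZMod m) (g : ZMod m → Fin 2) : Equiv.Perm (Fin 2 × ZMod m) where
  toFun x := (x.1 + g x.2, x.2 + e)
  invFun x := (x.1 - g (x.2 - e), x.2 - e)
  left_inv x := by simp
  right_inv x := by simp

/-- The permutation of `Fin 2 × ZMod m` that alternates between switching the first
coordinate and translating the second one by `1`; `p` is a parity on `ZMod m`, and the switch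
is applied where `x.1 + p x.2 = c`. -/
def zigzagPerm {m : ℕ} (p : ZMod m → Fin 2) (hp : ∀ i, p (i + 1) = p i + 1) (c : Fin 2) :
    Equiv.Perm (Fin 2 × ZMod m) where
  toFun x := if x.1 + p x.2 = c then (x.1 + 1, x.2) else (x.1, x.2 + 1)
  invFun x := if x.1 + p x.2 = c then (x.1, x.2 - 1) else (x.1 + 1, x.2)
  left_inv := by
    rintro ⟨a, i⟩
    by_cases h : a + p i = c <;>
      simp [h, hp, ← add_assoc, add_right_comm a 1, Fin.add_one_eq_iff_ne, Fin.add_one_add_one]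
  right_inv := by
    rintro ⟨a, i⟩
    have hi : p i = p (i - 1) + 1 := by rw [← hp, sub_add_cancel]
    by_cases h : a + p (i - 1) = c <;>
      simp [h, hi, ← add_assoc, add_right_comm a 1, Fin.add_one_eq_iff_ne, Fin.add_one_add_one]

theorem minimalPeriod_eq_of_forall_iterate_iff {α : Type*} {f : α → α} {x : α} {n : ℕ}
    (h : ∀ k, f^[k] x = x ↔ n ∣ k) : Function.minimalPeriod f x = n :=
  Nat.dvd_antisymm (Function.IsPeriodicPt.minimalPeriod_dvd ((h n).2 dvd_rfl))
    ((h _).1 (Function.iterate_minimalPeriod))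

theorem skewPerm_iterate {m : ℕ} (e : ZMod m) (g : ZMod m → Fin 2) (k : ℕ)
    (x : Fin 2 × ZMod m) :
    (skewPerm e g)^[k] x = (x.1 + ∑ j ∈ Finset.range k, g (x.2 + e * j), x.2 + e * k) := by
  induction k with
  | zero => simp
  | succ k ih =>
    rw [Function.iterate_succ_apply', ih, Finset.sum_range_succ]
    simp only [skewPerm, Equiv.coe_fn_mk, Prod.mk.injEq, Nat.cast_succ]
    exact ⟨add_assoc _ _ _, by ring⟩

theorem ZMod.sum_range_natCast {m : ℕ} [NeZero m] {M : Type*} [AddCommMonoid M]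
    (g : ZMod m → M) : ∑ j ∈ Finset.range m, g j = ∑ i, g i := by
  refine Finset.sum_bij' (fun j _ => (j : ZMod m)) (fun i _ => i.val) ?_ ?_ ?_ ?_ ?_
  · simp
  · simp [ZMod.val_lt]
  · intro j hj
    exact ZMod.val_cast_of_lt (Finset.mem_range.1 hj)
  · simp
  · simp

theorem skewPerm_iterate_self {m : ℕ} [NeZero m] {e : ZMod m} (he : IsUnit e)
    (g : ZMod m → Fin 2) (x : Fin 2 × ZMod m) :
    (skewPerm e g)^[m] x = (x.1 + ∑ i, g i, x.2) := by
  obtain ⟨u, rfl⟩ := he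
  rw [skewPerm_iterate, ZMod.sum_range_natCast (fun j : ZMod m => g (x.2 + u * j)),
    ← (u.mulLeft.trans (Equiv.addLeft x.2)).sum_comp g]
  simp

theorem skewPerm_iterate_mul {m : ℕ} [NeZero m] {e : ZMod m} (he : IsUnit e)
    (g : ZMod m → Fin 2) (q : ℕ) (x : Fin 2 × ZMod m) :
    (skewPerm e g)^[m * q] x = (x.1 + q • ∑ i, g i, x.2) := by
  rw [Function.iterate_mul]
  induction q with
  | zero => simp
  | succ q ih =>
    rw [Function.iterate_succ_apply', ih, skewPerm_iterate_self he, succ_nsmul, add_assoc]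

theorem dvd_of_skewPerm_iterate_eq {m : ℕ} {e : ZMod m} (he : IsUnit e)
    {g : ZMod m → Fin 2} {k : ℕ} {x : Fin 2 × ZMod m} (h : (skewPerm e g)^[k] x = x) :
    m ∣ k := by
  rw [skewPerm_iterate] at h
  have h2 := congrArg Prod.snd h
  simp only [add_eq_left, he.mul_right_eq_zero] at h2
  exact (ZMod.natCast_eq_zero_iff k m).1 h2

theorem minimalPeriod_skewPerm_of_sum_eq_zero {m : ℕ} [NeZero m] {e : ZMod m} (he : IsUnit e)
    {g : ZMod m → Fin 2} (hg : ∑ i, g i = 0) (x : Fin 2 × ZMod m) :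
    Function.minimalPeriod (skewPerm e g) x = m := by
  refine minimalPeriod_eq_of_forall_iterate_iff fun k => ⟨dvd_of_skewPerm_iterate_eq he, ?_⟩
  rintro ⟨q, rfl⟩
  simp [skewPerm_iterate_mul he, hg]

theorem Fin.nsmul_one_eq_zero_iff_even (q : ℕ) : q • (1 : Fin 2) = 0 ↔ 2 ∣ q := by
  rw [← ZMod.natCast_eq_zero_iff q 2, ← nsmul_one]
  rfl

theorem minimalPeriod_skewPerm_of_sum_eq_one {m : ℕ} [NeZero m] {e : ZMod m} (he : IsUnit e)
    {g : ZMod m → Fin 2} (hg : ∑ i, g i = 1) (x : Fin 2 × ZMod m) :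
    Function.minimalPeriod (skewPerm e g) x = 2 * m := by
  refine minimalPeriod_eq_of_forall_iterate_iff fun k => ?_
  have key (q : ℕ) : (skewPerm e g)^[m * q] x = x ↔ 2 ∣ q := by
    rw [skewPerm_iterate_mul he, hg, ← Fin.nsmul_one_eq_zero_iff_even]
    simp [Prod.ext_iff]
  rw [mul_comm 2 m]
  refine ⟨fun h => ?_, ?_⟩
  · obtain ⟨q, rfl⟩ := dvd_of_skewPerm_iterate_eq he h
    exact mul_dvd_mul_left m ((key q).1 h)
  · rintro ⟨q, rfl⟩
    rw [mul_assoc, key]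
    exact dvd_mul_right 2 q

section zigzag

variable {m : ℕ} {p : ZMod m → Fin 2} (hp : ∀ i, p (i + 1) = p i + 1) (c : Fin 2)

theorem zigzagPerm_apply (x : Fin 2 × ZMod m) :
    zigzagPerm p hp c x = if x.1 + p x.2 = c then (x.1 + 1, x.2) else (x.1, x.2 + 1) := rfl

theorem zigzagPerm_parity (x : Fin 2 × ZMod m) :
    (zigzagPerm p hp c x).1 + p (zigzagPerm p hp c x).2 = x.1 + p x.2 + 1 := by
  rw [zigzagPerm_apply]
  split_ifs
  · exact add_right_comm _ _ _
  · simp only [hp, add_assoc]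

theorem zigzagPerm_zigzagPerm (x : Fin 2 × ZMod m) :
    zigzagPerm p hp c (zigzagPerm p hp c x) = (x.1 + 1, x.2 + 1) := by
  have h := zigzagPerm_parity hp c x
  rw [zigzagPerm_apply hp c (zigzagPerm p hp c x), h, zigzagPerm_apply]
  generalize x.1 + p x.2 = b
  by_cases hb : b = c
  · simp [hb]
  · simp [hb, (Fin.add_one_eq_iff_ne b c).2 hb]

theorem zigzagPerm_iterate_two_mul (k : ℕ) (x : Fin 2 × ZMod m) :
    (zigzagPerm p hp c)^[2 * k] x = (x.1 + k • 1, x.2 + k) := by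
  rw [Function.iterate_mul]
  induction k with
  | zero => simp
  | succ k ih =>
    rw [Function.iterate_succ_apply', ih]
    simp only [Function.iterate_succ_apply, Function.iterate_zero_apply, zigzagPerm_zigzagPerm,
      succ_nsmul, add_assoc, Nat.cast_succ]

theorem zigzagPerm_iterate_parity (k : ℕ) (x : Fin 2 × ZMod m) :
    ((zigzagPerm p hp c)^[k] x).1 + p ((zigzagPerm p hp c)^[k] x).2 = x.1 + p x.2 + k • 1 := by
  induction k with
  | zero => simp
  | succ k ih =>
    rw [Function.iterate_succ_apply', zigzagPerm_parity, ih, succ_nsmul, add_assoc]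

theorem minimalPeriod_zigzagPerm (hm : Even m) (x : Fin 2 × ZMod m) :
    Function.minimalPeriod (zigzagPerm p hp c) x = 2 * m := by
  refine minimalPeriod_eq_of_forall_iterate_iff fun k => ?_
  have key (q : ℕ) : (zigzagPerm p hp c)^[2 * q] x = x ↔ m ∣ q := by
    rw [zigzagPerm_iterate_two_mul, Prod.ext_iff]
    simp only [add_eq_left, Fin.nsmul_one_eq_zero_iff_even, ZMod.natCast_eq_zero_iff]
    exact ⟨And.right, fun h => ⟨hm.two_dvd.trans h, h⟩⟩
  refine ⟨fun h => ?_, ?_⟩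
  · have hk := zigzagPerm_iterate_parity hp c k x
    rw [h, left_eq_add, Fin.nsmul_one_eq_zero_iff_even] at hk
    obtain ⟨q, rfl⟩ := hk
    exact mul_dvd_mul_left 2 ((key q).1 h)
  · rintro ⟨q, rfl⟩
    rw [mul_assoc, key]
    exact dvd_mul_right m q

end zigzag

theorem ZMod.exists_parity {m : ℕ} (hm : Even m) :
    ∃ p : ZMod m → Fin 2, ∀ i, p (i + 1) = p i + 1 :=
  ⟨ZMod.castHom hm.two_dvd (ZMod 2), fun i => by
    rw [map_add, map_one]
    rfl⟩

theorem ZMod.sum_one_eq_zero {m : ℕ} [NeZero m] (hm : Even m) :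
    ∑ _i : ZMod m, (1 : Fin 2) = 0 := by
  rw [Finset.sum_const, Finset.card_univ, ZMod.card, Fin.nsmul_one_eq_zero_iff_even]
  exact hm.two_dvd

/-- Two zigzag permutations, the crossing translation by `1`, and the two translations by `-1`
twisted by complementary cocycles use every arc exactly once. -/
theorem skewPerm_zigzagPerm_arcs {m : ℕ} (hm : 4 ≤ m) {p : ZMod m → Fin 2}
    (hp : ∀ i, p (i + 1) = p i + 1) (g : ZMod m → Fin 2)
    {f : Fin 5 → Equiv.Perm (Fin 2 × ZMod m)}
    (hf : f = ![skewPerm 1 (fun _ => 1), skewPerm (-1) g, skewPerm (-1) (fun i => g i + 1),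
      zigzagPerm p hp 0, zigzagPerm p hp 1]) :
    (∀ (i j : Fin 5) (x : Fin 2 × ZMod m), f i x = f j x → i = j) ∧
    (∀ q : (Fin 2 × ZMod m) × (Fin 2 × ZMod m),
      q ∈ cycleStarBlowup m ∪ IStar m ↔ ∃ i, f i q.1 = q.2) := by
  have h1 : (1 : ZMod m) ≠ 0 := by
    have := (ZMod.natCast_eq_zero_iff 1 m).not.2 (Nat.not_dvd_of_pos_of_lt (by omega) (by omega))
    exact_mod_cast this
  have h2 : (2 : ZMod m) ≠ 0 := by
    have := (ZMod.natCast_eq_zero_iff 2 m).not.2 (Nat.not_dvd_of_pos_of_lt (by omega) (by omega))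
    exact_mod_cast this
  have d1 (i : ZMod m) : i + 1 ≠ i + -1 := fun h => h2 (by linear_combination h)
  have d2 (i : ZMod m) : i + 1 ≠ i := by simpa using h1
  have d3 (i : ZMod m) : i + -1 ≠ i := by simpa using h1
  have two (a : Fin 2) : a = 0 ∨ a = 1 := by decide +revert
  subst hf
  constructor
  · rintro s t ⟨a, i⟩ h
    rcases two a with rfl | rfl <;> rcases two (p i) with hpi | hpi <;>
      rcases two (g i) with hgi | hgi <;> fin_cases s <;> fin_cases t <;>
      simp [skewPerm, zigzagPerm, hpi, hgi, d1, d2, d3, (d1 _).symm, (d2 _).symm,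
        (d3 _).symm] at h ⊢
  · rintro ⟨⟨a, i⟩, b, j⟩
    have hj : i = j + 1 ↔ i + -1 = j := by rw [← sub_eq_add_neg, sub_eq_iff_eq_add]
    simp only [cycleStarBlowup, IStar, Set.mem_union, Set.mem_ofPred_eq, hj, eq_comm (a := j),
      Fin.exists_fin_succ, IsEmpty.exists_iff, Matrix.cons_val_zero, Matrix.cons_val_succ,
      skewPerm, zigzagPerm, Equiv.coe_fn_mk]
    rcases two a with rfl | rfl <;> rcases two b with rfl | rfl <;>
      rcases two (p i) with hpi | hpi <;> rcases two (g i) with hgi | hgi <;>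
      simp [hpi, hgi, or_comm, or_left_comm]

/-- For even `m ≥ 4`, the digraph `C_m*[2] ⊕ I*_{2m}` has a factorization into `r`
`C⃗_m`-factors and `s` `C⃗_{2m}`-factors for every `r ∈ {1, 3}` with `r + s = 5`. -/
theorem cycleStarBlowup_IStar_Cm_C2m (m r s : ℕ) (hm : 4 ≤ m) (hme : Even m)
    (hr : r = 1 ∨ r = 3) (hrs : r + s = 5) :
    IsFactorization (cycleStarBlowup m ∪ IStar m)
      (fun i : Fin (r + s) => if (i : ℕ) < r then m else 2 * m) := by
  have : NeZero m := ⟨by omega⟩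
  obtain ⟨p, hp⟩ := ZMod.exists_parity hme
  have hone := ZMod.sum_one_eq_zero hme
  have hneg : IsUnit (-1 : ZMod m) := isUnit_one.neg
  rcases hr with rfl | rfl
  · obtain rfl : s = 4 := by omega
    have hsum : ∑ i : ZMod m, (if i = 0 then 1 else 0 : Fin 2) = 1 := by simp
    have hsum' : ∑ i : ZMod m, ((if i = 0 then 1 else 0 : Fin 2) + 1) = 1 := by
      rw [Finset.sum_add_distrib, hsum, hone, add_zero]
    refine ⟨_, fun t x => ?_, skewPerm_zigzagPerm_arcs hm hp (fun i => if i = 0 then 1 else 0) rfl⟩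
    fin_cases t
    · exact minimalPeriod_skewPerm_of_sum_eq_zero isUnit_one hone x
    · exact minimalPeriod_skewPerm_of_sum_eq_one hneg hsum x
    · exact minimalPeriod_skewPerm_of_sum_eq_one hneg hsum' x
    · exact minimalPeriod_zigzagPerm hp 0 hme x
    · exact minimalPeriod_zigzagPerm hp 1 hme x
  · obtain rfl : s = 2 := by omega
    refine ⟨_, fun t x => ?_, skewPerm_zigzagPerm_arcs hm hp (fun _ => 0) rfl⟩
    fin_cases t
    · exact minimalPeriod_skewPerm_of_sum_eq_zero isUnit_one hone x
    · exact minimalPeriod_skewPerm_of_sum_eq_zero hneg Finset.sum_const_zero x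
    · exact minimalPeriod_skewPerm_of_sum_eq_zero hneg hone x
    · exact minimalPeriod_zigzagPerm hp 0 hme x
    · exact minimalPeriod_zigzagPerm hp 1 hme x
end

section
/- Let m ≥ 4 be an even integer. Then the digraph C_m*[2] has a factorization into r C⃗_m-factors and s C⃗_{2m}-factors for every r ∈ {0, 2, 4} with r + s = 4. -/
/-- The permutation `(i, u) ↦ (i + t u, u + d)` of `Fin 2 × ZMod m`. -/
def twistPerm {m : ℕ} (d : ZMod m) (t : ZMod m → Fin 2) : Equiv.Perm (Fin 2 × ZMod m) where
  toFun x := (x.1 + t x.2, x.2 + d)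
  invFun y := (y.1 - t (y.2 - d), y.2 - d)
  left_inv x := by simp
  right_inv y := by simp

theorem twistPerm_apply {m : ℕ} (d : ZMod m) (t : ZMod m → Fin 2) (x : Fin 2 × ZMod m) :
    twistPerm d t x = (x.1 + t x.2, x.2 + d) := rfl

theorem twistPerm_iterate {m : ℕ} (d : ZMod m) (t : ZMod m → Fin 2) (n : ℕ)
    (x : Fin 2 × ZMod m) :
    (⇑(twistPerm d t))^[n] x = (x.1 + ∑ j ∈ Finset.range n, t (x.2 + j * d), x.2 + n * d) := by
  induction n with
  | zero => simp
  | succ n ih =>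
    rw [Function.iterate_succ_apply', ih, twistPerm_apply, Finset.sum_range_succ]
    ext1
    · simp only [add_assoc]
    · push_cast
      ring

theorem sum_range_add_mul_eq_sum_univ {m : ℕ} [NeZero m] {M : Type*} [AddCommMonoid M]
    {d : ZMod m} (hd : d * d = 1) (u : ZMod m) (t : ZMod m → M) :
    ∑ j ∈ Finset.range m, t (u + j * d) = ∑ v, t v := by
  refine Finset.sum_bij (fun j _ => u + j * d) (fun _ _ => Finset.mem_univ _) ?_ ?_
    (fun _ _ => rfl)
  · intro a ha b hb h
    have hab : (a : ZMod m) = b := by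
      linear_combination d * h + (b - a : ZMod m) * hd
    rw [ZMod.natCast_eq_natCast_iff'] at hab
    rwa [Nat.mod_eq_of_lt (Finset.mem_range.1 ha), Nat.mod_eq_of_lt (Finset.mem_range.1 hb)] at hab
  · intro v _
    refine ⟨((v - u) * d).val, Finset.mem_range.2 (ZMod.val_lt _), ?_⟩
    rw [ZMod.natCast_zmod_val]
    linear_combination (v - u) * hd

theorem minimalPeriod_twistPerm {m : ℕ} [NeZero m] {d : ZMod m} (hd : d * d = 1)
    (t : ZMod m → Fin 2) (x : Fin 2 × ZMod m) :
    Function.minimalPeriod (⇑(twistPerm d t)) x = if ∑ v, t v = 0 then m else 2 * m := by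
  have hm0 : m ≠ 0 := NeZero.ne m
  have hiter : (⇑(twistPerm d t))^[m] = fun y => (y.1 + ∑ v, t v, y.2) := by
    funext y
    rw [twistPerm_iterate, sum_range_add_mul_eq_sum_univ hd]
    simp
  have hdvd : m ∣ Function.minimalPeriod (⇑(twistPerm d t)) x := by
    have h := Function.iterate_minimalPeriod (f := ⇑(twistPerm d t)) (x := x)
    rw [twistPerm_iterate] at h
    have h2 := congrArg Prod.snd h
    simp only [add_eq_left] at h2
    rw [← ZMod.natCast_eq_zero_iff]
    linear_combination d * h2 - (Function.minimalPeriod (⇑(twistPerm d t)) x : ZMod m) * hd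
  split_ifs with h
  · refine Nat.dvd_antisymm (Function.IsPeriodicPt.minimalPeriod_dvd ?_) hdvd
    rw [Function.IsPeriodicPt, Function.IsFixedPt, hiter, h]
    simp
  · have hper : Function.minimalPeriod (⇑(twistPerm d t)) x ∣ 2 * m := by
      refine Function.IsPeriodicPt.minimalPeriod_dvd ?_
      rw [Function.IsPeriodicPt, Function.IsFixedPt, two_mul, Function.iterate_add, hiter]
      have h2 : ∀ a b : Fin 2, a + b + b = a := by decide
      simp [h2]
    obtain ⟨k, hk⟩ := hdvd
    rw [hk, mul_comm 2 m] at hper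
    have hk2 : k ∣ 2 := Nat.dvd_of_mul_dvd_mul_left (Nat.pos_of_ne_zero hm0) hper
    rcases (Nat.dvd_prime Nat.prime_two).1 hk2 with rfl | rfl
    · have hfix := Function.iterate_minimalPeriod (f := ⇑(twistPerm d t)) (x := x)
      rw [hk, mul_one, hiter] at hfix
      exact absurd (by simpa using congrArg Prod.fst hfix) h
    · rw [hk, mul_comm]

theorem sum_const_add_ite_eq {m : ℕ} [NeZero m] (hme : Even m) (c e : Fin 2) :
    ∑ v : ZMod m, (c + if v = 0 then e else 0) = e := by
  obtain ⟨k, rfl⟩ := hme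
  have h2 : ∀ a : Fin 2, a + a = 0 := by decide
  rw [Finset.sum_add_distrib, Finset.sum_const, Finset.card_univ, ZMod.card, add_nsmul, h2]
  simp

/-- The two forward factors have cycle length governed by `e₀`, the two backward factors by
`e₁`; either kind of length can be prescribed independently. -/
theorem isFactorization_cycleStarBlowup {m : ℕ} (hm : 4 ≤ m) (hme : Even m) (e₀ e₁ : Fin 2) :
    IsFactorization (cycleStarBlowup m)
      (fun i : Fin 4 => if ![e₀, e₀, e₁, e₁] i = 0 then m else 2 * m) := by
  have : NeZero m := ⟨by omega⟩
  have hne : (1 : ZMod m) ≠ -1 := by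
    intro h
    have h2 : ((2 : ℕ) : ZMod m) = 0 := by
      push_cast
      linear_combination h
    rw [ZMod.natCast_eq_zero_iff] at h2
    exact absurd (Nat.le_of_dvd two_pos h2) (by omega)
  let d : Fin 4 → ZMod m := ![1, 1, -1, -1]
  let c : Fin 4 → Fin 2 := ![0, 1, 0, 1]
  have hd : ∀ i, d i * d i = 1 := by
    intro i
    fin_cases i <;> simp [d]
  refine ⟨fun i => twistPerm (d i) (fun u => c i + if u = 0 then ![e₀, e₀, e₁, e₁] i else 0),
    fun i x => ?_, fun i j x h => ?_, fun p => ?_⟩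
  · rw [minimalPeriod_twistPerm (hd i), sum_const_add_ite_eq hme]
  · simp only [twistPerm_apply, Prod.mk.injEq, add_right_inj] at h
    obtain ⟨h1, h2⟩ := h
    fin_cases i <;> fin_cases j <;> simp_all [d, c, hne.symm]
  · obtain ⟨⟨a, u⟩, ⟨b, v⟩⟩ := p
    have key : ∀ a b e : Fin 2, a + (0 + e) = b ∨ a + (1 + e) = b := by decide
    simp only [cycleStarBlowup, Set.mem_ofPred_eq, twistPerm_apply, Prod.mk.injEq,
      Fin.exists_fin_succ, d, c]
    have hu : u = v + 1 ↔ u + -1 = v := by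
      rw [← sub_eq_add_neg, sub_eq_iff_eq_add]
    rw [eq_comm, hu]
    have k0 := key a b (if u = 0 then e₀ else 0)
    have k1 := key a b (if u = 0 then e₁ else 0)
    simp only [zero_add] at k0 k1
    simp
    tauto

/-- For even `m ≥ 4`, the digraph `C_m*[2]` has a factorization into `r` `C⃗_m`-factors
and `s` `C⃗_{2m}`-factors for every `r ∈ {0, 2, 4}` with `r + s = 4`. -/
theorem cycleStarBlowup_Cm_C2m (m r s : ℕ) (hm : 4 ≤ m) (hme : Even m)
    (hr : r = 0 ∨ r = 2 ∨ r = 4) (hrs : r + s = 4) :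
    IsFactorization (cycleStarBlowup m)
      (fun i : Fin (r + s) => if (i : ℕ) < r then m else 2 * m) := by
  obtain rfl : s = 4 - r := by omega
  rcases hr with rfl | rfl | rfl
  · convert isFactorization_cycleStarBlowup hm hme 1 1 using 1
    funext i
    fin_cases i <;> rfl
  · convert isFactorization_cycleStarBlowup hm hme 0 1 using 1
    funext i
    fin_cases i <;> rfl
  · convert isFactorization_cycleStarBlowup hm hme 0 0 using 1
    funext i
    fin_cases i <;> rfl
end
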